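/- arXiv:1202.4375 — 9 statements merged into one kernel-verified Lean document; each statement's English description precedes it below -/
import Mathlib

section
/- Let A, B ⊆ ℝⁿ be closed and disjoint, ω : [0,∞) → ℝⁿ continuous, and 0 ≤ t ≤ T. Set τ̄ := min(τ_{A∪B}(ω,t), T) (a finite time). Then ω(τ̄) ∈ A if and only if τ_A(ω,t) ≤ T and τ_A(ω,t) < τ_B(ω,t). (This is the pathwise event identity underlying Proposition 3.1: the event that the path reaches A no later than T and strictly before entering B coincides with the event that the stopped path at τ̄ lies in A.) -/
open scoped ENNReal NNReal

/-- First entry time after `t` of the path `ω` into the set `S`, valued in `[0,∞]`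
(with `inf ∅ = ∞`). -/
noncomputable def entryTime {n : ℕ} (ω : ℝ≥0 → EuclideanSpace ℝ (Fin n)) (t : ℝ≥0)
    (S : Set (EuclideanSpace ℝ (Fin n))) : ℝ≥0∞ :=
  ⨅ s ∈ {s : ℝ≥0 | t ≤ s ∧ ω s ∈ S}, (s : ℝ≥0∞)

theorem entryTime_le {n : ℕ} {ω : ℝ≥0 → EuclideanSpace ℝ (Fin n)} {t s : ℝ≥0}
    {S : Set (EuclideanSpace ℝ (Fin n))} (hts : t ≤ s) (hs : ω s ∈ S) :
    entryTime ω t S ≤ s :=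
  iInf₂_le (f := fun (s : ℝ≥0) (_ : s ∈ {s : ℝ≥0 | t ≤ s ∧ ω s ∈ S}) => (s : ℝ≥0∞)) s ⟨hts, hs⟩

theorem le_entryTime {n : ℕ} (ω : ℝ≥0 → EuclideanSpace ℝ (Fin n)) (t : ℝ≥0)
    (S : Set (EuclideanSpace ℝ (Fin n))) : (t : ℝ≥0∞) ≤ entryTime ω t S :=
  le_iInf₂ fun _ hs => ENNReal.coe_le_coe.2 hs.1

theorem entryTime_union {n : ℕ} (ω : ℝ≥0 → EuclideanSpace ℝ (Fin n)) (t : ℝ≥0)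
    (A B : Set (EuclideanSpace ℝ (Fin n))) :
    entryTime ω t (A ∪ B) = min (entryTime ω t A) (entryTime ω t B) := by
  refine le_antisymm (le_min ?_ ?_) (le_iInf₂ ?_)
  · exact le_iInf₂ fun s hs => entryTime_le hs.1 (Or.inl hs.2)
  · exact le_iInf₂ fun s hs => entryTime_le hs.1 (Or.inr hs.2)
  · rintro s ⟨hts, hs | hs⟩
    · exact (min_le_left _ _).trans (entryTime_le hts hs)
    · exact (min_le_right _ _).trans (entryTime_le hts hs)

/-- A continuous path that enters a closed set lies in it at its first entry time. -/
theorem mem_of_entryTime_ne_top {n : ℕ} {ω : ℝ≥0 → EuclideanSpace ℝ (Fin n)}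
    (hω : Continuous ω) {t : ℝ≥0} {S : Set (EuclideanSpace ℝ (Fin n))} (hS : IsClosed S)
    (h : entryTime ω t S ≠ ∞) : ω (entryTime ω t S).toNNReal ∈ S := by
  have hne : {s : ℝ≥0 | t ≤ s ∧ ω s ∈ S}.Nonempty := by
    rw [Set.nonempty_iff_ne_empty]
    intro he
    exact h (by simp [entryTime, he])
  have hcl : IsClosed {s : ℝ≥0 | t ≤ s ∧ ω s ∈ S} :=
    isClosed_Ici.inter (hS.preimage hω)
  have hmem := hcl.csInf_mem hne (OrderBot.bddBelow _)
  have heq : entryTime ω t S = (sInf {s : ℝ≥0 | t ≤ s ∧ ω s ∈ S} : ℝ≥0) :=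
    le_antisymm (entryTime_le hmem.1 hmem.2)
      (le_iInf₂ fun s hs => ENNReal.coe_le_coe.2 (csInf_le (OrderBot.bddBelow _) hs))
  rw [heq, ENNReal.toNNReal_coe]
  exact hmem.2

/-- Pathwise event identity underlying Proposition 3.1: with `τ̄ = min (τ_{A∪B}, T)`,
the stopped path lies in `A` iff it reaches `A` no later than `T` and strictly
before entering `B`. -/
theorem stopped_mem_iff {n : ℕ} (A B : Set (EuclideanSpace ℝ (Fin n)))
    (hA : IsClosed A) (hB : IsClosed B) (hAB : Disjoint A B)
    (ω : ℝ≥0 → EuclideanSpace ℝ (Fin n)) (hω : Continuous ω)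
    (t T : ℝ≥0) (htT : t ≤ T) :
    ω (min (entryTime ω t (A ∪ B)) (T : ℝ≥0∞)).toNNReal ∈ A ↔
      entryTime ω t A ≤ (T : ℝ≥0∞) ∧ entryTime ω t A < entryTime ω t B := by
  constructor
  · intro h
    set m := min (entryTime ω t (A ∪ B)) (T : ℝ≥0∞) with hm
    have hmT : m ≤ T := min_le_right _ _
    have hmtop : m ≠ ∞ := ne_top_of_le_ne_top ENNReal.coe_ne_top hmT
    have htm : t ≤ m.toNNReal := by
      rw [← ENNReal.coe_le_coe, ENNReal.coe_toNNReal hmtop]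
      exact le_min (le_entryTime ω t _) (ENNReal.coe_le_coe.2 htT)
    have hAm : entryTime ω t A ≤ m := by
      simpa only [ENNReal.coe_toNNReal hmtop] using entryTime_le htm h
    have hmB : m ≤ entryTime ω t B :=
      (min_le_left _ _).trans ((entryTime_union ω t A B).trans_le (min_le_right _ _))
    refine ⟨hAm.trans hmT, lt_of_le_of_ne (hAm.trans hmB) fun he => ?_⟩
    have hAtop : entryTime ω t A ≠ ∞ := ne_top_of_le_ne_top hmtop hAm
    have hmemA := mem_of_entryTime_ne_top hω hA hAtop
    have hmemB := mem_of_entryTime_ne_top hω hB (he ▸ hAtop)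
    rw [← he] at hmemB
    exact Set.disjoint_left.1 hAB hmemA hmemB
  · rintro ⟨hAT, hlt⟩
    rw [entryTime_union, min_eq_left hlt.le, min_eq_left hAT]
    exact mem_of_entryTime_ne_top hω hA hlt.ne_top
end

section
/- Let A, B ⊆ ℝⁿ be closed and disjoint, ω : [0,∞) → ℝⁿ continuous, and 0 ≤ t ≤ T. Set τ̄ := min(τ_{A∪B}(ω,t), T). Then for every s ∈ [t,T], setting σ̄ := min(s, τ_B(ω,t)) (a finite time), one has min( 1_A(ω(s)), 1_{ℝⁿ∖B}(ω(σ̄)) ) ≤ 1_A(ω(τ̄)), where 1_S denotes the real-valued indicator of S; that is, if ω(s) ∈ A and ω(σ̄) ∉ B then ω(τ̄) ∈ A. (Pathwise inequality used to prove V₃ ≤ V₁ in Proposition 3.2.) -/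
open scoped ENNReal NNReal

/-- The first entry time of a continuous path into a closed set it visits is attained. -/
theorem exists_isLeast_entryTime_eq {n : ℕ} {ω : ℝ≥0 → EuclideanSpace ℝ (Fin n)}
    (hω : Continuous ω) {S : Set (EuclideanSpace ℝ (Fin n))} (hS : IsClosed S) {t s : ℝ≥0}
    (hts : t ≤ s) (hs : ω s ∈ S) :
    ∃ r : ℝ≥0, IsLeast {u : ℝ≥0 | t ≤ u ∧ ω u ∈ S} r ∧ entryTime ω t S = r := by
  have hclosed : IsClosed {u : ℝ≥0 | t ≤ u ∧ ω u ∈ S} :=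
    isClosed_Ici.inter (hS.preimage hω)
  have hleast := hclosed.isLeast_csInf ⟨s, hts, hs⟩ (OrderBot.bddBelow _)
  exact ⟨_, hleast, le_antisymm (iInf₂_le _ hleast.1)
    (le_iInf₂ fun u hu => ENNReal.coe_le_coe.2 (hleast.2 hu))⟩

/-- Pathwise inequality used to prove `V₃ ≤ V₁` in Proposition 3.2: with
`τ̄ = min (τ_{A∪B}, T)` and, for `s ∈ [t,T]`, `σ̄ = min(s, τ_B)`, one has
`min(1_A(ω(s)), 1_{Bᶜ}(ω(σ̄))) ≤ 1_A(ω(τ̄))`; that is, if `ω(s) ∈ A` and `ω(σ̄) ∉ B`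
then `ω(τ̄) ∈ A`. -/
theorem stopped_indicator_min_le {n : ℕ} (A B : Set (EuclideanSpace ℝ (Fin n)))
    (hA : IsClosed A) (hB : IsClosed B) (hAB : Disjoint A B)
    (ω : ℝ≥0 → EuclideanSpace ℝ (Fin n)) (hω : Continuous ω)
    (t T : ℝ≥0) (htT : t ≤ T) :
    ∀ s ∈ Set.Icc t T,
      (min (A.indicator (fun _ => (1 : ℝ)) (ω s))
          (Bᶜ.indicator (fun _ => (1 : ℝ))
            (ω (min (s : ℝ≥0∞) (entryTime ω t B)).toNNReal)) ≤
        A.indicator (fun _ => (1 : ℝ))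
          (ω (min (entryTime ω t (A ∪ B)) (T : ℝ≥0∞)).toNNReal)) ∧
      (ω s ∈ A → ω (min (s : ℝ≥0∞) (entryTime ω t B)).toNNReal ∉ B →
        ω (min (entryTime ω t (A ∪ B)) (T : ℝ≥0∞)).toNNReal ∈ A) := by
  intro s hs
  have key : ω s ∈ A → ω (min (s : ℝ≥0∞) (entryTime ω t B)).toNNReal ∉ B →
      ω (min (entryTime ω t (A ∪ B)) (T : ℝ≥0∞)).toNNReal ∈ A := by
    intro hsA hσ
    obtain ⟨r, hr, hr_eq⟩ :=
      exists_isLeast_entryTime_eq hω (hA.union hB) hs.1 (Or.inl hsA)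
    have hrs : r ≤ s := hr.2 ⟨hs.1, Or.inl hsA⟩
    rw [hr_eq, min_eq_left (ENNReal.coe_le_coe.2 (hrs.trans hs.2)), ENNReal.toNNReal_coe]
    refine hr.1.2.resolve_right fun hrB => hσ ?_
    obtain ⟨q, hq, hq_eq⟩ := exists_isLeast_entryTime_eq hω hB hr.1.1 hrB
    have hqs : q ≤ s := (hq.2 ⟨hr.1.1, hrB⟩).trans hrs
    rw [hq_eq, min_eq_right (ENNReal.coe_le_coe.2 hqs), ENNReal.toNNReal_coe]
    exact hq.1.2
  refine ⟨?_, key⟩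
  have hnonneg := Set.indicator_nonneg (s := A) (f := fun _ => (1 : ℝ))
    (fun _ _ => zero_le_one) (ω (min (entryTime ω t (A ∪ B)) (T : ℝ≥0∞)).toNNReal)
  by_cases hsA : ω s ∈ A
  · by_cases hσ : ω (min (s : ℝ≥0∞) (entryTime ω t B)).toNNReal ∈ B
    · exact (min_le_right _ _).trans
        ((Set.indicator_of_notMem (Set.notMem_compl_iff.2 hσ) _).le.trans hnonneg)
    · rw [Set.indicator_of_mem hsA, Set.indicator_of_mem (key hsA hσ)]
      exact min_le_left _ _
  · exact (min_le_left _ _).trans ((Set.indicator_of_notMem hsA _).le.trans hnonneg)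
end

section
/- Let B ⊆ ℝⁿ be closed, A ⊆ ℝⁿ a set disjoint from B, ω : [0,∞) → ℝⁿ continuous, and 0 ≤ t ≤ T. Set τ̃ := min(τ_B(ω,t), T). Then ω(τ̃) ∈ A if and only if ω(T) ∈ A and ω(r) ∉ B for every r ∈ [t,T]. (Pathwise event identity underlying Proposition 3.3 for the reach-avoid problem at the terminal time.) -/
open scoped ENNReal NNReal

/-- If the path visits a set at or after time `t`, the entry time is the infimum of the
visiting times. -/
theorem entryTime_eq_coe_sInf {n : ℕ} {ω : ℝ≥0 → EuclideanSpace ℝ (Fin n)} {t : ℝ≥0}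
    {S : Set (EuclideanSpace ℝ (Fin n))} (h : {s : ℝ≥0 | t ≤ s ∧ ω s ∈ S}.Nonempty) :
    entryTime ω t S = ((sInf {s : ℝ≥0 | t ≤ s ∧ ω s ∈ S} : ℝ≥0) : ℝ≥0∞) :=
  (ENNReal.coe_sInf h).symm

/-- A continuous path is in a closed set at its entry time, if that time is finite. -/
theorem sInf_visiting_times_mem {n : ℕ} {ω : ℝ≥0 → EuclideanSpace ℝ (Fin n)}
    (hω : Continuous ω) {t : ℝ≥0} {S : Set (EuclideanSpace ℝ (Fin n))} (hS : IsClosed S)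
    (h : {s : ℝ≥0 | t ≤ s ∧ ω s ∈ S}.Nonempty) :
    ω (sInf {s : ℝ≥0 | t ≤ s ∧ ω s ∈ S}) ∈ S :=
  ((isClosed_Ici.inter (hS.preimage hω)).csInf_mem h (OrderBot.bddBelow _)).2

/-- If the path avoids a set on `[t, T]`, the entry time is at least `T`. -/
theorem le_entryTime_of_forall_notMem {n : ℕ} {ω : ℝ≥0 → EuclideanSpace ℝ (Fin n)}
    {t T : ℝ≥0} {S : Set (EuclideanSpace ℝ (Fin n))} (h : ∀ r ∈ Set.Icc t T, ω r ∉ S) :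
    (T : ℝ≥0∞) ≤ entryTime ω t S :=
  le_iInf₂ fun s hs => ENNReal.coe_le_coe.2 <|
    le_of_not_ge fun hsT => h s ⟨hs.1, hsT⟩ hs.2

/-- Pathwise event identity underlying Proposition 3.3 (reach-avoid at the terminal time):
with `τ̃ = min (τ_B, T)`, `ω(τ̃) ∈ A` iff `ω(T) ∈ A` and `ω(r) ∉ B` for every `r ∈ [t,T]`. -/
theorem stopped_terminal_mem_iff {n : ℕ} (A B : Set (EuclideanSpace ℝ (Fin n)))
    (hB : IsClosed B) (hAB : Disjoint A B)
    (ω : ℝ≥0 → EuclideanSpace ℝ (Fin n)) (hω : Continuous ω)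
    (t T : ℝ≥0) (htT : t ≤ T) :
    ω (min (entryTime ω t B) (T : ℝ≥0∞)).toNNReal ∈ A ↔
      ω T ∈ A ∧ ∀ r ∈ Set.Icc t T, ω r ∉ B := by
  by_cases h : ∀ r ∈ Set.Icc t T, ω r ∉ B
  · rw [min_eq_right (le_entryTime_of_forall_notMem h), ENNReal.toNNReal_coe]
    exact ⟨fun hA => ⟨hA, h⟩, And.left⟩
  · refine iff_of_false (fun hA => ?_) fun hA => h hA.2
    push Not at h
    obtain ⟨r, ⟨htr, hrT⟩, hr⟩ := h
    have hmem : r ∈ {s : ℝ≥0 | t ≤ s ∧ ω s ∈ B} := ⟨htr, hr⟩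
    have hle : sInf {s : ℝ≥0 | t ≤ s ∧ ω s ∈ B} ≤ T :=
      (csInf_le' hmem).trans hrT
    rw [entryTime_eq_coe_sInf ⟨r, hmem⟩, min_eq_left (ENNReal.coe_le_coe.2 hle),
      ENNReal.toNNReal_coe] at hA
    exact Set.disjoint_left.1 hAB hA (sInf_visiting_times_mem hω hB ⟨r, hmem⟩)
end

section
/- Let K ⊆ ℝⁿ be closed and T > 0. Let ω and ω_1, ω_2, … : [0,∞) → ℝⁿ be continuous, with ω_n → ω uniformly on [0,T], and let t_n → t be a convergent sequence in [0,T]. Then liminf_{n→∞} min(τ_K(ω_n, t_n), T) ≥ min(τ_K(ω, t), T); that is, the (truncated) first entry time into a closed set is lower semicontinuous under uniform convergence of paths and convergence of initial times. (Deterministic core of the liminf step in the proof of Proposition 4.2.) -/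
open scoped ENNReal NNReal

/-- Lower semicontinuity of the truncated first entry time into a closed set under uniform
convergence of continuous paths and convergence of initial times (liminf step in the proof
of Proposition 4.2). -/
theorem liminf_entryTime_ge {n : ℕ} (K : Set (EuclideanSpace ℝ (Fin n))) (hK : IsClosed K)
    (T : ℝ≥0) (hT : 0 < T)
    (ω : ℝ≥0 → EuclideanSpace ℝ (Fin n)) (hω : Continuous ω)
    (ωseq : ℕ → ℝ≥0 → EuclideanSpace ℝ (Fin n)) (hωseq : ∀ k, Continuous (ωseq k))
    (hunif : TendstoUniformlyOn ωseq ω Filter.atTop (Set.Icc 0 T))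
    (tseq : ℕ → ℝ≥0) (t : ℝ≥0) (htseq : ∀ k, tseq k ∈ Set.Icc 0 T) (ht : t ∈ Set.Icc 0 T)
    (htconv : Filter.Tendsto tseq Filter.atTop (nhds t)) :
    min (entryTime ω t K) (T : ℝ≥0∞) ≤
      Filter.liminf (fun k => min (entryTime (ωseq k) (tseq k) K) (T : ℝ≥0∞))
        Filter.atTop := by
  by_contra! hlt
  obtain ⟨a, hla, ha⟩ := exists_between hlt
  obtain ⟨haE, haT⟩ := lt_min_iff.1 ha
  obtain ⟨φ, hφ, hφa⟩ := Filter.extraction_of_frequently_atTop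
    (Filter.frequently_lt_of_liminf_lt (by isBoundedDefault) hla)
  have hentry : ∀ k, ∃ s : ℝ≥0, tseq (φ k) ≤ s ∧ ωseq (φ k) s ∈ K ∧ (s : ℝ≥0∞) < a := by
    intro k
    have hk : entryTime (ωseq (φ k)) (tseq (φ k)) K < a :=
      (min_lt_iff.1 (hφa k)).resolve_right haT.not_gt
    simpa only [entryTime, iInf_lt_iff, Set.mem_ofPred_eq, exists_prop, and_assoc] using hk
  choose s hts hsK hsa using hentry
  have hsT : ∀ k, s k ∈ Set.Icc 0 T := fun k =>
    ⟨zero_le, ENNReal.coe_le_coe.1 ((hsa k).trans haT).le⟩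
  obtain ⟨σ, -, ψ, hψ, hσ⟩ := isCompact_Icc.tendsto_subseq hsT
  have hsub : Filter.Tendsto (φ ∘ ψ) Filter.atTop Filter.atTop :=
    hφ.tendsto_atTop.comp hψ.tendsto_atTop
  have htσ : t ≤ σ := le_of_tendsto_of_tendsto' (htconv.comp hsub) hσ fun k => hts (ψ k)
  have hlim : Filter.Tendsto (fun k => ωseq (φ (ψ k)) (s (ψ k))) Filter.atTop (nhds (ω σ)) := by
    refine ((hω.tendsto σ).comp hσ).congr_dist ?_
    rw [Metric.tendsto_nhds]
    intro ε hε
    filter_upwards [hsub.eventually (Metric.tendstoUniformlyOn_iff.1 hunif ε hε)] with k hk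
    simpa using hk _ (hsT (ψ k))
  have hσK : ω σ ∈ K := hK.mem_of_tendsto hlim (.of_forall fun k => hsK (ψ k))
  have hσa : (σ : ℝ≥0∞) ≤ a :=
    le_of_tendsto' (ENNReal.tendsto_coe.2 hσ) fun k => (hsa (ψ k)).le
  exact haE.not_ge ((iInf₂_le σ ⟨htσ, hσK⟩).trans hσa)
end

section
/- Let A, B ⊆ ℝⁿ be closed and disjoint, ω : [0,∞) → ℝⁿ continuous, 0 ≤ t ≤ T, and let 0 < ε₂ ≤ ε₁ with A_{ε₁} nonempty. For ε > 0 set τ_ε := min(τ_{A_ε ∪ B}(ω,t), T). Then ℓ_{ε₂}(ω(τ_{ε₂})) ≥ ℓ_{ε₁}(ω(τ_{ε₁})); that is, the stopped payoff is pathwise monotone in ε. (Pathwise monotonicity step in the proof of Theorem 5.1, yielding V_{ε₂} ≥ V_{ε₁}.) -/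
open scoped ENNReal NNReal

/-- The inner `ε`-approximation `A_ε = {x ∈ A : dist(x, Aᶜ) ≥ ε}`. -/
def innerApprox {n : ℕ} (A : Set (EuclideanSpace ℝ (Fin n))) (ε : ℝ) :
    Set (EuclideanSpace ℝ (Fin n)) :=
  {x ∈ A | ε ≤ Metric.infDist x Aᶜ}

/-- The payoff `ℓ_ε(x) = max(1 - dist(x, A_ε)/ε, 0)`. -/
noncomputable def payoff {n : ℕ} (A : Set (EuclideanSpace ℝ (Fin n))) (ε : ℝ)
    (x : EuclideanSpace ℝ (Fin n)) : ℝ :=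
  max (1 - Metric.infDist x (innerApprox A ε) / ε) 0

theorem entryTime_mem {n : ℕ} {ω : ℝ≥0 → EuclideanSpace ℝ (Fin n)} (hω : Continuous ω)
    {t : ℝ≥0} {S : Set (EuclideanSpace ℝ (Fin n))} (hS : IsClosed S)
    (h : entryTime ω t S ≠ ⊤) :
    ∃ s : ℝ≥0, t ≤ s ∧ ω s ∈ S ∧ entryTime ω t S = s := by
  have hcl : IsClosed {s : ℝ≥0 | t ≤ s ∧ ω s ∈ S} :=
    isClosed_Ici.inter (hS.preimage hω)
  have hne : {s : ℝ≥0 | t ≤ s ∧ ω s ∈ S}.Nonempty := by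
    by_contra hempty
    rw [Set.not_nonempty_iff_eq_empty] at hempty
    exact h (by simp [entryTime, hempty])
  have hmem := hcl.csInf_mem hne (OrderBot.bddBelow _)
  exact ⟨_, hmem.1, hmem.2, (ENNReal.coe_sInf hne).symm⟩

theorem entryTime_anti {n : ℕ} (ω : ℝ≥0 → EuclideanSpace ℝ (Fin n)) (t : ℝ≥0)
    {S S' : Set (EuclideanSpace ℝ (Fin n))} (h : S ⊆ S') :
    entryTime ω t S' ≤ entryTime ω t S :=
  le_iInf₂ fun _ hs => entryTime_le hs.1 (h hs.2)

theorem innerApprox_anti {n : ℕ} (A : Set (EuclideanSpace ℝ (Fin n))) {ε δ : ℝ} (h : δ ≤ ε) :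
    innerApprox A ε ⊆ innerApprox A δ :=
  fun _ hx => ⟨hx.1, h.trans hx.2⟩

theorem isClosed_innerApprox {n : ℕ} {A : Set (EuclideanSpace ℝ (Fin n))} (hA : IsClosed A)
    (ε : ℝ) : IsClosed (innerApprox A ε) :=
  hA.inter (isClosed_le continuous_const (Metric.continuous_infDist_pt _))

theorem mem_innerApprox_of_dist_le {n : ℕ} {A : Set (EuclideanSpace ℝ (Fin n))} {ε δ : ℝ}
    (hδ : 0 < δ) {y z : EuclideanSpace ℝ (Fin n)} (hy : y ∈ innerApprox A ε)
    (hyz : dist y z ≤ ε - δ) : z ∈ innerApprox A δ := by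
  have hle : δ ≤ Metric.infDist z Aᶜ := by
    have := Metric.infDist_le_infDist_add_dist (s := Aᶜ) (x := y) (y := z)
    linarith [hy.2]
  refine ⟨?_, hle⟩
  by_contra hz
  rw [Metric.infDist_zero_of_mem (s := Aᶜ) hz] at hle
  linarith

theorem payoff_le_one {n : ℕ} (A : Set (EuclideanSpace ℝ (Fin n))) {ε : ℝ} (hε : 0 ≤ ε)
    (x : EuclideanSpace ℝ (Fin n)) : payoff A ε x ≤ 1 := by
  have : 0 ≤ Metric.infDist x (innerApprox A ε) / ε := div_nonneg Metric.infDist_nonneg hε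
  exact max_le (by linarith) zero_le_one

theorem payoff_eq_one_of_mem {n : ℕ} {A : Set (EuclideanSpace ℝ (Fin n))} {ε : ℝ}
    {x : EuclideanSpace ℝ (Fin n)} (hx : x ∈ innerApprox A ε) : payoff A ε x = 1 := by
  simp [payoff, Metric.infDist_zero_of_mem hx]

theorem payoff_anti {n : ℕ} {A : Set (EuclideanSpace ℝ (Fin n))} (hA : IsClosed A) {ε δ : ℝ}
    (hδ : 0 < δ) (hδε : δ ≤ ε) (hne : (innerApprox A ε).Nonempty)
    (x : EuclideanSpace ℝ (Fin n)) : payoff A ε x ≤ payoff A δ x := by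
  have hε : 0 < ε := hδ.trans_le hδε
  obtain ⟨y, hy, hxy⟩ := (isClosed_innerApprox hA ε).exists_infDist_eq_dist hne x
  unfold payoff
  rw [hxy]
  rcases le_total (dist x y) ε with hr | hr
  · have hle : Metric.infDist x (innerApprox A δ) ≤ δ / ε * dist x y := by
      have hq : δ / ε ≤ 1 := (div_le_one hε).2 hδε
      have hz : AffineMap.lineMap x y (δ / ε) ∈ innerApprox A δ := by
        refine mem_innerApprox_of_dist_le hδ hy ?_
        rw [dist_comm, dist_lineMap_right, Real.norm_of_nonneg (sub_nonneg.2 hq)]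
        calc (1 - δ / ε) * dist x y ≤ (1 - δ / ε) * ε :=
              mul_le_mul_of_nonneg_left hr (sub_nonneg.2 hq)
          _ = ε - δ := by field_simp
      refine (Metric.infDist_le_dist_of_mem hz).trans_eq ?_
      rw [dist_left_lineMap, Real.norm_of_nonneg (by positivity)]
    refine max_le_max_right 0 (sub_le_sub_left ?_ 1)
    rw [div_le_iff₀ hδ]
    exact hle.trans_eq (by ring)
  · refine max_le (le_max_of_le_right ?_) (le_max_right _ _)
    rw [sub_nonpos]
    exact (one_le_div hε).2 hr

/-- Pathwise monotonicity step in the proof of Theorem 5.1 (yielding `V_{ε₂} ≥ V_{ε₁}`):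
with `τ_ε = min (τ_{A_ε ∪ B}, T)`, the stopped payoff `ℓ_ε(ω(τ_ε))` is pathwise monotone
in `ε`. -/
theorem stopped_payoff_monotone {n : ℕ} (A B : Set (EuclideanSpace ℝ (Fin n)))
    (hA : IsClosed A) (hB : IsClosed B) (hAB : Disjoint A B)
    (ω : ℝ≥0 → EuclideanSpace ℝ (Fin n)) (hω : Continuous ω)
    (t T : ℝ≥0) (htT : t ≤ T) (ε₁ ε₂ : ℝ) (h₂ : 0 < ε₂) (h₁₂ : ε₂ ≤ ε₁)
    (hne : (innerApprox A ε₁).Nonempty) :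
    payoff A ε₁
        (ω (min (entryTime ω t (innerApprox A ε₁ ∪ B)) (T : ℝ≥0∞)).toNNReal) ≤
      payoff A ε₂
        (ω (min (entryTime ω t (innerApprox A ε₂ ∪ B)) (T : ℝ≥0∞)).toNNReal) := by
  set S₁ := innerApprox A ε₁ ∪ B
  set S₂ := innerApprox A ε₂ ∪ B
  have hτ : entryTime ω t S₂ ≤ entryTime ω t S₁ :=
    entryTime_anti ω t (Set.union_subset_union_left B (innerApprox_anti A h₁₂))
  by_cases heq : min (entryTime ω t S₂) (T : ℝ≥0∞) = min (entryTime ω t S₁) (T : ℝ≥0∞)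
  · rw [heq]
    exact payoff_anti hA h₂ h₁₂ hne _
  have hlt : entryTime ω t S₂ < T := by
    by_contra! hT
    exact heq (by rw [min_eq_right hT, min_eq_right (hT.trans hτ)])
  obtain ⟨s, hts, hs, hsτ⟩ :=
    entryTime_mem hω ((isClosed_innerApprox hA ε₂).union hB) hlt.ne_top
  rcases hs with hs | hs
  · rw [min_eq_left hlt.le, hsτ, ENNReal.toNNReal_coe, payoff_eq_one_of_mem hs]
    exact payoff_le_one A (h₂.le.trans h₁₂) _
  · have hle : entryTime ω t S₁ ≤ s := entryTime_le hts (Or.inr hs)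
    exact (heq (by rw [hτ.antisymm (hle.trans_eq hsτ.symm)])).elim
end

section
/- Let A, B ⊆ ℝⁿ be closed and disjoint, ω : [0,∞) → ℝⁿ continuous, 0 ≤ t ≤ T, and ε > 0 with A_ε nonempty. Set τ_ε := min(τ_{A_ε ∪ B}(ω,t), T) and τ̄ := min(τ_{A ∪ B}(ω,t), T). Then ℓ_ε(ω(τ_ε)) ≤ 1_A(ω(τ̄)), where 1_A denotes the real-valued indicator of A. (Pathwise inequality asserting V ≥ V_ε in Theorem 5.1.) -/
open scoped ENNReal NNReal

/-- A finite entry time of a continuous path into a closed set is attained. -/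
theorem exists_entryTime_eq {n : ℕ} {ω : ℝ≥0 → EuclideanSpace ℝ (Fin n)} (hω : Continuous ω)
    (t : ℝ≥0) {S : Set (EuclideanSpace ℝ (Fin n))} (hS : IsClosed S)
    (h : entryTime ω t S ≠ ∞) : ∃ s : ℝ≥0, entryTime ω t S = s ∧ t ≤ s ∧ ω s ∈ S := by
  have hne : {s : ℝ≥0 | t ≤ s ∧ ω s ∈ S}.Nonempty := by
    by_contra hem
    rw [Set.not_nonempty_iff_eq_empty] at hem
    exact h (by simp only [entryTime, hem]; simp)
  have hcl : IsClosed {s : ℝ≥0 | t ≤ s ∧ ω s ∈ S} := isClosed_Ici.inter (hS.preimage hω)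
  exact ⟨_, (ENNReal.coe_sInf hne).symm, hcl.csInf_mem hne (OrderBot.bddBelow _)⟩

theorem payoff_eq_zero_of_notMem {n : ℕ} {A : Set (EuclideanSpace ℝ (Fin n))} {ε : ℝ}
    (hε : 0 < ε) (hne : (innerApprox A ε).Nonempty) {x : EuclideanSpace ℝ (Fin n)}
    (hx : x ∉ A) : payoff A ε x = 0 := by
  have hdist : ε ≤ Metric.infDist x (innerApprox A ε) :=
    (Metric.le_infDist hne).2 fun y hy =>
      (hy.2.trans (Metric.infDist_le_dist_of_mem hx)).trans_eq (dist_comm y x)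
  exact max_eq_right (sub_nonpos.2 ((one_le_div hε).2 hdist))

/-- If the path stopped at `min (τ_{A ∪ B}, T)` is not in `A`, then entry into any `A' ∪ B` with
`A' ⊆ A` leads to the same stopping time. -/
theorem min_entryTime_union_eq {n : ℕ} {A A' B : Set (EuclideanSpace ℝ (Fin n))}
    (hA : IsClosed A) (hB : IsClosed B) (hA' : A' ⊆ A)
    {ω : ℝ≥0 → EuclideanSpace ℝ (Fin n)} (hω : Continuous ω) (t T : ℝ≥0)
    (h : ω (min (entryTime ω t (A ∪ B)) (T : ℝ≥0∞)).toNNReal ∉ A) :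
    min (entryTime ω t (A' ∪ B)) (T : ℝ≥0∞) = min (entryTime ω t (A ∪ B)) (T : ℝ≥0∞) := by
  have hle := entryTime_anti ω t (Set.union_subset_union_left B hA')
  rcases le_total (entryTime ω t (A ∪ B)) T with hT | hT
  · obtain ⟨s, hs, hts, hmem⟩ := exists_entryTime_eq hω t (hA.union hB)
      (ne_top_of_le_ne_top ENNReal.coe_ne_top hT)
    rw [min_eq_left hT, hs, ENNReal.toNNReal_coe] at h
    have hsB : ω s ∈ A' ∪ B := Or.inr (hmem.resolve_left h)
    rw [le_antisymm ((entryTime_le hts hsB).trans_eq hs.symm) hle]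
  · rw [min_eq_right hT, min_eq_right (hT.trans hle)]

/-- Pathwise inequality asserting `V ≥ V_ε` in Theorem 5.1: with
`τ_ε = min (τ_{A_ε ∪ B}, T)` and `τ̄ = min (τ_{A ∪ B}, T)`, one has
`ℓ_ε(ω(τ_ε)) ≤ 1_A(ω(τ̄))`. -/
theorem stopped_payoff_le_indicator {n : ℕ} (A B : Set (EuclideanSpace ℝ (Fin n)))
    (hA : IsClosed A) (hB : IsClosed B) (hAB : Disjoint A B)
    (ω : ℝ≥0 → EuclideanSpace ℝ (Fin n)) (hω : Continuous ω)
    (t T : ℝ≥0) (htT : t ≤ T) (ε : ℝ) (hε : 0 < ε)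
    (hne : (innerApprox A ε).Nonempty) :
    payoff A ε (ω (min (entryTime ω t (innerApprox A ε ∪ B)) (T : ℝ≥0∞)).toNNReal) ≤
      A.indicator (fun _ => (1 : ℝ))
        (ω (min (entryTime ω t (A ∪ B)) (T : ℝ≥0∞)).toNNReal) := by
  by_cases h : ω (min (entryTime ω t (A ∪ B)) (T : ℝ≥0∞)).toNNReal ∈ A
  · rw [Set.indicator_of_mem h]
    exact payoff_le_one A hε.le _
  · have hsub : innerApprox A ε ⊆ A := Set.sep_subset _ _
    rw [Set.indicator_of_notMem h, min_entryTime_union_eq hA hB hsub hω t T h,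
      payoff_eq_zero_of_notMem hε hne h]
end

section
/- Let A ⊆ ℝⁿ with ℝⁿ∖A nonempty, let ω : [0,∞) → ℝⁿ be any function, and let t ≥ 0. Then ⨅_{ε > 0} τ_{A_ε}(ω,t) = τ_{interior A}(ω,t), where the infimum is taken in [0,∞]. (Identity combining the nested approximations A_ε with entry times, used in the proof of Theorem 5.1 to pass from ⋂_n {τ_{A_n} > τ_B ∧ T} to {τ_{A°} ≥ τ_B ∧ T}.) -/
open scoped ENNReal NNReal

theorem exists_mem_innerApprox_iff {n : ℕ} {A : Set (EuclideanSpace ℝ (Fin n))}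
    (hc : Aᶜ.Nonempty) (x : EuclideanSpace ℝ (Fin n)) :
    (∃ ε : ℝ, 0 < ε ∧ x ∈ innerApprox A ε) ↔ x ∈ interior A := by
  have h : x ∈ interior A ↔ 0 < Metric.infDist x Aᶜ := by
    rw [interior_eq_compl_closure_compl, Set.mem_compl_iff]
    exact Metric.infDist_pos_iff_notMem_closure hc
  rw [h]
  constructor
  · rintro ⟨ε, hε, -, hx⟩
    exact hε.trans_le hx
  · intro hx
    exact ⟨_, hx, interior_subset (h.2 hx), le_rfl⟩

/-- Identity combining the nested approximations `A_ε` with entry times, used in the proof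
of Theorem 5.1: `⨅_{ε > 0} τ_{A_ε}(ω,t) = τ_{interior A}(ω,t)`. -/
theorem iInf_entryTime_innerApprox {n : ℕ} (A : Set (EuclideanSpace ℝ (Fin n)))
    (hc : Aᶜ.Nonempty) (ω : ℝ≥0 → EuclideanSpace ℝ (Fin n)) (t : ℝ≥0) :
    ⨅ (ε : ℝ) (_ : 0 < ε), entryTime ω t (innerApprox A ε) =
      entryTime ω t (interior A) := by
  refine le_antisymm ?_ ?_
  · refine le_iInf₂ fun s hs => ?_
    obtain ⟨ε, hε, hx⟩ := (exists_mem_innerApprox_iff hc _).2 hs.2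
    exact (iInf₂_le ε hε).trans (iInf₂_le s ⟨hs.1, hx⟩)
  · refine le_iInf₂ fun ε hε => le_iInf₂ fun s hs => ?_
    exact iInf₂_le s ⟨hs.1, (exists_mem_innerApprox_iff hc _).1 ⟨ε, hε, hs.2⟩⟩
end

section
/- Let A ⊆ ℝⁿ satisfy the interior cone condition: there exist constants h > 0, r > 0, M ≥ 0 and a map η : ℝⁿ → ℝⁿ with ‖η(x)‖ ≤ M for all x, such that for every x in the closure of A and every s ∈ (0,h], the open ball of radius r·s centered at x + s·η(x) is contained in A. Then the frontier of A (the closure of A minus the interior of A) has n-dimensional Lebesgue measure zero. (Claim used in the proof of Theorem 5.1: the interior cone condition implies that the Lebesgue measure of ∂A is zero.) -/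
open scoped ENNReal NNReal

open Metric Set Filter Topology MeasureTheory in
/-- A set `S` is null for a uniformly locally doubling measure if, at each of its points `x`, there
are balls disjoint from `S`, of radii tending to zero, whose centers are at distance from `x` at most
a fixed multiple of their radii. -/
theorem IsUnifLocDoublingMeasure.measure_zero_of_disjoint_closedBall {X : Type*}
    [PseudoMetricSpace X] [MeasurableSpace X] (μ : Measure X) [IsUnifLocDoublingMeasure μ]
    [SecondCountableTopology X] [BorelSpace X] [IsLocallyFiniteMeasure μ] {S : Set X} (K : ℝ)
    (w : X → ℝ → X)
    (hw : ∀ x ∈ S, ∀ᶠ δ in 𝓝[>] 0,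
      dist x (w x δ) ≤ K * δ ∧ Disjoint S (closedBall (w x δ) δ)) :
    μ S = 0 := by
  have hae : ∀ᵐ x ∂μ.restrict S, x ∉ S := by
    filter_upwards [IsUnifLocDoublingMeasure.ae_tendsto_measure_inter_div μ S K] with x hx hxS
    have hlim := hx (w x) id tendsto_id ((hw x hxS).mono fun δ hδ ↦ hδ.1)
    have hzero : (fun δ ↦ μ (S ∩ closedBall (w x δ) (id δ)) / μ (closedBall (w x δ) (id δ)))
        =ᶠ[𝓝[>] 0] fun _ ↦ 0 :=
      (hw x hxS).mono fun δ hδ ↦ by simp [hδ.2.inter_eq]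
    exact zero_ne_one (tendsto_nhds_unique (tendsto_const_nhds.congr' hzero.symm) hlim)
  have hnull := ae_iff.mp hae
  simp only [not_not, ofPred_mem_eq] at hnull
  rwa [Measure.restrict_apply_self] at hnull

/-- If `A ⊆ ℝⁿ` satisfies the interior cone condition — there are constants `h > 0`,
`r > 0`, `M ≥ 0` and a bounded map `η` such that for every `x` in the closure of `A` and
every `s ∈ (0,h]` the open ball of radius `r·s` centered at `x + s·η(x)` is contained in
`A` — then the frontier of `A` has `n`-dimensional Lebesgue measure zero. -/
theorem frontier_volume_zero_of_coneCondition {n : ℕ}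
    (A : Set (EuclideanSpace ℝ (Fin n))) (h r M : ℝ) (hh : 0 < h) (hr : 0 < r)
    (hM : 0 ≤ M) (η : EuclideanSpace ℝ (Fin n) → EuclideanSpace ℝ (Fin n))
    (hη : ∀ x, ‖η x‖ ≤ M)
    (hcone : ∀ x ∈ closure A, ∀ s : ℝ, 0 < s → s ≤ h →
      Metric.ball (x + s • η x) (r * s) ⊆ A) :
    MeasureTheory.volume (frontier A) = 0 := by
  refine IsUnifLocDoublingMeasure.measure_zero_of_disjoint_closedBall MeasureTheory.volume
    (2 * M / r) (fun x δ ↦ x + (2 * δ / r) • η x) fun x hx ↦ ?_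
  filter_upwards [Ioo_mem_nhdsGT (show 0 < r * h / 2 by positivity)] with δ hδ
  obtain ⟨hδ0, hδh⟩ := hδ
  have hs : 0 < 2 * δ / r := by positivity
  constructor
  · rw [dist_self_add_right, norm_smul, Real.norm_of_nonneg hs.le]
    calc 2 * δ / r * ‖η x‖ ≤ 2 * δ / r * M := by gcongr; exact hη x
      _ = 2 * M / r * δ := by ring
  · have hsh : 2 * δ / r ≤ h := by
      rw [div_le_iff₀ hr]
      linarith
    have hball : Metric.closedBall (x + (2 * δ / r) • η x) δ ⊆
        Metric.ball (x + (2 * δ / r) • η x) (r * (2 * δ / r)) := by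
      apply Metric.closedBall_subset_ball
      rw [mul_div_cancel₀ _ hr.ne']
      linarith
    have hint := hball.trans
      (interior_maximal (hcone x (frontier_subset_closure hx) _ hs hsh) Metric.isOpen_ball)
    exact disjoint_interior_frontier.symm.mono_right hint
end

section
/- Let O ⊆ ℝⁿ, T > 0, and for a path ω' : [0,∞) → ℝⁿ, a time t' ∈ [0,T], and a set S ⊆ ℝⁿ write τ̄_S(ω',t') := min(τ_S(ω',t'), T). Let ω and ω_1, ω_2, … : [0,∞) → ℝⁿ be continuous with ω_n → ω uniformly on [0,T], and let t_n → t in [0,T]. Assume the path ω is regular for O from (t,·), in the sense that τ̄_{closure O}(ω,t) = τ̄_{interior O}(ω,t). Then τ̄_O(ω_n,t_n) → τ̄_O(ω,t) and ω_n(τ̄_O(ω_n,t_n)) → ω(τ̄_O(ω,t)) as n → ∞. (Deterministic core of Proposition 4.2 and Lemma 5.1: continuity of the truncated exit time and of the stopped path under uniform convergence.) -/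
open scoped ENNReal NNReal

/-- The first entry time truncated at the horizon `T`, as a finite time. -/
noncomputable def truncEntryTime {n : ℕ} (ω : ℝ≥0 → EuclideanSpace ℝ (Fin n)) (t : ℝ≥0)
    (S : Set (EuclideanSpace ℝ (Fin n))) (T : ℝ≥0) : ℝ≥0 :=
  (min (entryTime ω t S) (T : ℝ≥0∞)).toNNReal

section EntryTime

open Filter Topology Set

variable {n : ℕ}

theorem entryTime_lt_iff {ω : ℝ≥0 → EuclideanSpace ℝ (Fin n)} {t : ℝ≥0}
    {S : Set (EuclideanSpace ℝ (Fin n))} {a : ℝ≥0∞} :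
    entryTime ω t S < a ↔ ∃ s : ℝ≥0, t ≤ s ∧ ω s ∈ S ∧ (s : ℝ≥0∞) < a := by
  simp [entryTime, iInf_lt_iff, and_assoc]

theorem coe_truncEntryTime (ω : ℝ≥0 → EuclideanSpace ℝ (Fin n)) (t : ℝ≥0)
    (S : Set (EuclideanSpace ℝ (Fin n))) (T : ℝ≥0) :
    (truncEntryTime ω t S T : ℝ≥0∞) = min (entryTime ω t S) T :=
  ENNReal.coe_toNNReal (ne_top_of_le_ne_top ENNReal.coe_ne_top (min_le_right _ _))

theorem truncEntryTime_lt_iff {ω : ℝ≥0 → EuclideanSpace ℝ (Fin n)} {t : ℝ≥0}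
    {S : Set (EuclideanSpace ℝ (Fin n))} {T a : ℝ≥0} :
    truncEntryTime ω t S T < a ↔ (∃ s, t ≤ s ∧ ω s ∈ S ∧ s < a) ∨ T < a := by
  rw [← ENNReal.coe_lt_coe, coe_truncEntryTime, min_lt_iff, entryTime_lt_iff]
  simp only [ENNReal.coe_lt_coe]

theorem truncEntryTime_le (ω : ℝ≥0 → EuclideanSpace ℝ (Fin n)) (t : ℝ≥0)
    (S : Set (EuclideanSpace ℝ (Fin n))) (T : ℝ≥0) : truncEntryTime ω t S T ≤ T := by
  rw [← ENNReal.coe_le_coe, coe_truncEntryTime]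
  exact min_le_right _ _

theorem truncEntryTime_anti (ω : ℝ≥0 → EuclideanSpace ℝ (Fin n)) (t : ℝ≥0)
    {S S' : Set (EuclideanSpace ℝ (Fin n))} (h : S ⊆ S') (T : ℝ≥0) :
    truncEntryTime ω t S' T ≤ truncEntryTime ω t S T := by
  refine le_of_forall_gt fun a ha => ?_
  rw [truncEntryTime_lt_iff] at ha ⊢
  exact ha.imp_left fun ⟨s, hts, hs, hsa⟩ => ⟨s, hts, h hs, hsa⟩

variable {ι : Type*} {l : Filter ι} {O : Set (EuclideanSpace ℝ (Fin n))} {T : ℝ≥0}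
  {ω : ℝ≥0 → EuclideanSpace ℝ (Fin n)} {ωseq : ι → ℝ≥0 → EuclideanSpace ℝ (Fin n)}
  {tseq : ι → ℝ≥0} {t a : ℝ≥0}

/-- The truncated entry time into the interior is an asymptotic upper bound. -/
theorem eventually_truncEntryTime_lt (hω : Continuous ω)
    (hunif : TendstoUniformlyOn ωseq ω l (Icc 0 T)) (htconv : Tendsto tseq l (𝓝 t))
    (ha : truncEntryTime ω t (interior O) T < a) :
    ∀ᶠ k in l, truncEntryTime (ωseq k) (tseq k) O T < a := by
  rcases lt_or_ge T a with hTa | haT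
  · exact Eventually.of_forall fun k => (truncEntryTime_le _ _ _ _).trans_lt hTa
  obtain ⟨s, hts, hs, hsa⟩ := (truncEntryTime_lt_iff.1 ha).resolve_right haT.not_gt
  have hopen : ∀ᶠ u in 𝓝[>] s, ω u ∈ interior O :=
    (hω.continuousAt.eventually_mem (isOpen_interior.mem_nhds hs)).filter_mono
      nhdsWithin_le_nhds
  have : (𝓝[>] s).NeBot := nhdsGT_neBot_of_exists_gt ⟨a, hsa⟩
  obtain ⟨u, hu, hsu, hua⟩ := (hopen.and (Ioo_mem_nhdsGT hsa)).exists
  have hconv := hunif.tendsto_at (x := u) ⟨zero_le, hua.le.trans haT⟩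
  filter_upwards [hconv.eventually_mem (isOpen_interior.mem_nhds hu),
    htconv.eventually_le_const (hts.trans_lt hsu)] with k hk htk
  exact truncEntryTime_lt_iff.2 (Or.inl ⟨u, htk, interior_subset hk, hua⟩)

/-- The truncated entry time into the closure is an asymptotic lower bound. -/
theorem eventually_lt_truncEntryTime (hω : Continuous ω)
    (hunif : TendstoUniformlyOn ωseq ω l (Icc 0 T)) (htconv : Tendsto tseq l (𝓝 t))
    (ha : a < truncEntryTime ω t (closure O) T) :
    ∀ᶠ k in l, a < truncEntryTime (ωseq k) (tseq k) O T := by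
  obtain ⟨b, hab, hb⟩ := exists_between ha
  have hbT : b < T := hb.trans_le (truncEntryTime_le _ _ _ _)
  have hlocal : ∀ s ∈ Icc 0 b, ∀ᶠ z in l ×ˢ 𝓝 s,
      ¬ (tseq z.1 ≤ z.2 ∧ ωseq z.1 z.2 ∈ O) := by
    intro s hs
    rcases lt_or_ge s t with hst | hts
    · filter_upwards [tendsto_snd.eventually_lt (htconv.comp tendsto_fst) hst] with z hz h
      exact h.1.not_gt hz
    have hsO : ω s ∉ closure O := fun h =>
      (truncEntryTime_lt_iff.2 (Or.inl ⟨s, hts, h, hs.2.trans_lt hb⟩)).false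
    have hTs : Icc 0 T ∈ 𝓝 s := by
      filter_upwards [Iio_mem_nhds (hs.2.trans_lt hbT)] with u hu using ⟨zero_le, hu.le⟩
    have hconv : Tendsto (fun z : ι × ℝ≥0 => ωseq z.1 z.2) (l ×ˢ 𝓝 s) (𝓝 (ω s)) :=
      tendsto_comp_of_locally_uniform_limit hω.continuousAt tendsto_snd fun u hu =>
        ⟨_, hTs, tendsto_fst.eventually (hunif u hu)⟩
    filter_upwards [hconv.eventually_mem (isClosed_closure.isOpen_compl.mem_nhds hsO)]
      with z hz h
    exact hz (subset_closure h.2)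
  have hprod : ∀ᶠ z in l ×ˢ 𝓝ˢ (Icc 0 b), ¬ (tseq z.1 ≤ z.2 ∧ ωseq z.1 z.2 ∈ O) := by
    rw [isCompact_Icc.prod_nhdsSet_eq_biSup]
    simpa only [eventually_iSup] using hlocal
  filter_upwards [hprod.curry] with k hk
  refine hab.trans_le (not_lt.1 fun h => ?_)
  obtain ⟨s, hts, hs, hsb⟩ := (truncEntryTime_lt_iff.1 h).resolve_right hbT.not_gt
  exact hk.self_of_nhdsSet s ⟨zero_le, hsb.le⟩ ⟨hts, hs⟩

end EntryTime

/-- Deterministic core of Proposition 4.2 and Lemma 5.1: if the limiting path is regular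
for `O` (its truncated entry times into the closure and the interior of `O` agree), then
under uniform convergence of paths and convergence of initial times, both the truncated
entry times and the stopped paths converge. -/
theorem truncEntryTime_continuous {n : ℕ} (O : Set (EuclideanSpace ℝ (Fin n)))
    (T : ℝ≥0) (hT : 0 < T)
    (ω : ℝ≥0 → EuclideanSpace ℝ (Fin n)) (hω : Continuous ω)
    (ωseq : ℕ → ℝ≥0 → EuclideanSpace ℝ (Fin n)) (hωseq : ∀ k, Continuous (ωseq k))
    (hunif : TendstoUniformlyOn ωseq ω Filter.atTop (Set.Icc 0 T))
    (tseq : ℕ → ℝ≥0) (t : ℝ≥0) (htseq : ∀ k, tseq k ∈ Set.Icc 0 T) (ht : t ∈ Set.Icc 0 T)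
    (htconv : Filter.Tendsto tseq Filter.atTop (nhds t))
    (hreg : truncEntryTime ω t (closure O) T = truncEntryTime ω t (interior O) T) :
    Filter.Tendsto (fun k => truncEntryTime (ωseq k) (tseq k) O T) Filter.atTop
      (nhds (truncEntryTime ω t O T)) ∧
    Filter.Tendsto (fun k => ωseq k (truncEntryTime (ωseq k) (tseq k) O T)) Filter.atTop
      (nhds (ω (truncEntryTime ω t O T))) := by
  have hle := truncEntryTime_anti ω t (subset_closure (s := O)) T
  have hge := truncEntryTime_anti ω t (interior_subset (s := O)) T
  have htime : Filter.Tendsto (fun k => truncEntryTime (ωseq k) (tseq k) O T) Filter.atTop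
      (nhds (truncEntryTime ω t O T)) :=
    tendsto_order.2
      ⟨fun a ha => eventually_lt_truncEntryTime hω hunif htconv
        (ha.trans_le (hge.trans hreg.ge)),
      fun a ha => eventually_truncEntryTime_lt hω hunif htconv
        ((hreg.ge.trans hle).trans_lt ha)⟩
  refine ⟨htime, ?_⟩
  exact tendsto_comp_of_locally_uniform_limit_within (s := Set.Icc 0 T) hω.continuousWithinAt
    (tendsto_nhdsWithin_iff.2 ⟨htime, Filter.Eventually.of_forall fun k =>
      ⟨zero_le, truncEntryTime_le _ _ _ _⟩⟩)
    fun u hu => ⟨_, self_mem_nhdsWithin, hunif u hu⟩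
end
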